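/- Let 0 < l_1 < l_2 and let w be an aperiodic recurrent infinite binary word that is an infinite concatenation of words from {0^{l_1}1, 0^{l_2}1}. If each factor of w has at most three abelian returns, then l_2 = l_1 + 1. -/

import Mathlib

variable {α : Type*}

/-- The factor of the infinite word `w` of length `n` starting at position `i`. -/
def factorAt (w : ℕ → α) (i n : ℕ) : List α :=
  (List.range n).map fun k => w (i + k)

/-- `u` is a factor of the infinite word `w`. -/
def IsFactor (w : ℕ → α) (u : List α) : Prop :=
  ∃ i, factorAt w i u.length = u

/-- `w` is recurrent: each of its factors occurs infinitely many times. -/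
def Recurrent (w : ℕ → α) : Prop :=
  ∀ u : List α, IsFactor w u → ∀ N : ℕ, ∃ i, N ≤ i ∧ factorAt w i u.length = u

/-- `w` is periodic: there is `T > 0` with `w (n + T) = w n` for all `n`. -/
def Periodic (w : ℕ → α) : Prop :=
  ∃ T : ℕ, 0 < T ∧ ∀ n, w (n + T) = w n

def Aperiodic (w : ℕ → α) : Prop := ¬ Periodic w

def UltimatelyPeriodic (w : ℕ → α) : Prop :=
  ∃ N T : ℕ, 0 < T ∧ ∀ n, N ≤ n → w (n + T) = w n

/-- `w` is Sturmian: aperiodic with subword complexity `n + 1`. -/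
def Sturmian (w : ℕ → α) : Prop :=
  Aperiodic w ∧ ∀ n : ℕ, {u : List α | u.length = n ∧ IsFactor w u}.ncard = n + 1

/-- Positions where `u` occurs in `w`. -/
def Occurrences (w : ℕ → α) (u : List α) : Set ℕ :=
  {i | factorAt w i u.length = u}

/-- The return words of `u` in `w`: words from one occurrence of `u` to the next. -/
def ReturnWords (w : ℕ → α) (u : List α) : Set (List α) :=
  {r | ∃ i j : ℕ, i ∈ Occurrences w u ∧ j ∈ Occurrences w u ∧ i < j ∧
    (∀ k, i < k → k < j → k ∉ Occurrences w u) ∧ r = factorAt w i (j - i)}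

/-- Positions where a word abelian-equivalent to `u` occurs in `w`. -/
def AbelianOccurrences (w : ℕ → α) (u : List α) : Set ℕ :=
  {i | List.Perm (factorAt w i u.length) u}

/-- The abelian return words of `u` in `w`. -/
def AbelianReturnWords (w : ℕ → α) (u : List α) : Set (List α) :=
  {r | ∃ i j : ℕ, i ∈ AbelianOccurrences w u ∧ j ∈ AbelianOccurrences w u ∧ i < j ∧
    (∀ k, i < k → k < j → k ∉ AbelianOccurrences w u) ∧ r = factorAt w i (j - i)}

/-- The abelian equivalence classes (as multisets) of the abelian return words of `u` in `w`. -/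
def abelianReturnClasses (w : ℕ → α) (u : List α) : Set (Multiset α) :=
  (fun r : List α => (r : Multiset α)) '' AbelianReturnWords w u

def RightSpecial (w : ℕ → α) (u : List α) : Prop :=
  ∃ a b : α, a ≠ b ∧ IsFactor w (u ++ [a]) ∧ IsFactor w (u ++ [b])

def LeftSpecial (w : ℕ → α) (u : List α) : Prop :=
  ∃ a b : α, a ≠ b ∧ IsFactor w (a :: u) ∧ IsFactor w (b :: u)

def Bispecial (w : ℕ → α) (u : List α) : Prop :=
  RightSpecial w u ∧ LeftSpecial w u

/-- A factor is singular if it is the only factor of `w` in its abelian class. -/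
def Singular (w : ℕ → α) (u : List α) : Prop :=
  ∀ v : List α, IsFactor w v → List.Perm v u → v = u

/-- `w` is an infinite concatenation of words from `S`. -/
def InfConcat (S : Set (List α)) (w : ℕ → α) : Prop :=
  ∃ f : ℕ → List α, (∀ n, f n ∈ S) ∧
    ∀ n, factorAt w (((List.range n).map fun k => (f k).length).sum) (f n).length = f n

/-- A finite binary word is balanced if any two factors of equal length have numbers
of occurrences of `true` differing by at most one. -/
def BalancedList (w : List Bool) : Prop :=
  ∀ u v : List Bool, u <:+: w → v <:+: w → u.length = v.length →
    |(u.count true : ℤ) - (v.count true : ℤ)| ≤ 1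


/-- The number of occurrences of `true` in `w` strictly before position `x`. -/
def onesBefore (w : ℕ → Bool) (x : ℕ) : ℕ := Nat.count (fun i => w i = true) x

/-- `p` enumerates the positions of `true` in `w`, with consecutive gaps equal to `A` or `B`. -/
structure OnesEnum (w : ℕ → Bool) (p : ℕ → ℕ) (A B : ℕ) : Prop where
  mem_iff : ∀ x, w x = true ↔ ∃ i, p i = x
  gap : ∀ i, p (i + 1) = p i + A ∨ p (i + 1) = p i + B
  zero_pos : 0 < p 0

theorem length_factorAt (w : ℕ → α) (x n : ℕ) : (factorAt w x n).length = n := by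
  simp [factorAt]

theorem count_true_factorAt (w : ℕ → Bool) (x n : ℕ) :
    onesBefore w x + (factorAt w x n).count true = onesBefore w (x + n) := by
  induction n with
  | zero => simp [factorAt]
  | succ n ih =>
    have e : factorAt w x (n + 1) = factorAt w x n ++ [w (x + n)] := by
      simp [factorAt, List.range_succ]
    rw [e, List.count_append, ← add_assoc, ih, ← add_assoc x n 1]
    simp only [onesBefore, Nat.count_succ]
    cases w (x + n) <;> simp

theorem perm_iff_of_length_eq {u v : List Bool} (h : u.length = v.length) :
    u.Perm v ↔ u.count true = v.count true := by
  refine ⟨fun hp => hp.count_eq _, fun hc => List.perm_iff_count.2 fun b => ?_⟩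
  have hu := List.count_not_add_count u true
  have hv := List.count_not_add_count v true
  cases b
  · simp only [Bool.not_true] at hu hv
    omega
  · exact hc

theorem mem_abelianOccurrences_iff {w : ℕ → Bool} {x n t : ℕ}
    (hx : onesBefore w (x + n) = onesBefore w x + t) (y : ℕ) :
    y ∈ AbelianOccurrences w (factorAt w x n) ↔
      onesBefore w (y + n) = onesBefore w y + t := by
  have h1 := count_true_factorAt w x n
  have h2 := count_true_factorAt w y n
  simp only [AbelianOccurrences, Set.mem_ofPred_eq, length_factorAt]
  rw [perm_iff_of_length_eq (by simp only [length_factorAt])]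
  omega

namespace OnesEnum

variable {w : ℕ → Bool} {p : ℕ → ℕ} {A B : ℕ}

theorem strictMono (hp : OnesEnum w p A B) (hA : 2 ≤ A) (hB : 2 ≤ B) : StrictMono p :=
  strictMono_nat_of_lt_succ fun i => by have := hp.gap i; omega

theorem onesBefore_apply (hp : OnesEnum w p A B) (hA : 2 ≤ A) (hB : 2 ≤ B) (i : ℕ) :
    onesBefore w (p i) = i := by
  have hm := hp.strictMono hA hB
  rw [onesBefore, Nat.count_eq_card_filter_range]
  have : (Finset.range (p i)).filter (fun x => w x = true) = (Finset.range i).image p := by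
    ext x
    simp only [Finset.mem_filter, Finset.mem_range, Finset.mem_image, hp.mem_iff]
    constructor
    · rintro ⟨hx, k, rfl⟩
      exact ⟨k, hm.lt_iff_lt.1 hx, rfl⟩
    · rintro ⟨k, hk, rfl⟩
      exact ⟨hm hk, k, rfl⟩
  rw [this, Finset.card_image_of_injective _ hm.injective, Finset.card_range]

theorem onesBefore_le_iff (hp : OnesEnum w p A B) (hA : 2 ≤ A) (hB : 2 ≤ B) (x i : ℕ) :
    onesBefore w x ≤ i ↔ x ≤ p i := by
  have h := hp.onesBefore_apply hA hB i
  refine ⟨fun hx => ?_, fun hx => h ▸ Nat.count_monotone _ hx⟩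
  by_contra! hlt
  have h1 : onesBefore w (p i + 1) = i + 1 := by
    rw [onesBefore, Nat.count_succ, if_pos ((hp.mem_iff _).2 ⟨i, rfl⟩)]
    exact congrArg (· + 1) h
  have h2 : onesBefore w (p i + 1) ≤ onesBefore w x := Nat.count_monotone _ hlt
  omega

theorem onesBefore_eq_succ_iff (hp : OnesEnum w p A B) (hA : 2 ≤ A) (hB : 2 ≤ B) (x i : ℕ) :
    onesBefore w x = i + 1 ↔ p i < x ∧ x ≤ p (i + 1) := by
  have h1 := hp.onesBefore_le_iff hA hB x i
  have h2 := hp.onesBefore_le_iff hA hB x (i + 1)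
  omega

end OnesEnum

/-- The pairs (number of blocks, length) separating consecutive indices `i` with
`p (i + m) = p i + T`. -/
def spanReturns (p : ℕ → ℕ) (m T : ℕ) : Set (ℕ × ℕ) :=
  {r | ∃ i, 0 < r.1 ∧ p (i + m) = p i + T ∧ p (i + r.1 + m) = p (i + r.1) + T ∧
    (∀ k, i < k → k < i + r.1 → p (k + m) ≠ p k + T) ∧ p (i + r.1) = p i + r.2}

namespace OnesEnum

variable {w : ℕ → Bool} {p : ℕ → ℕ} {A B : ℕ}

/-- If the windows of length `n` with `t` ones are those starting at `q i` and `q i + 1`,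
for `i` such that `p (i + m) = p i + T`, then there are at most two span returns. -/
theorem encard_spanReturns_le (hp : OnesEnum w p A B) (hA : 2 ≤ A) (hB : 2 ≤ B)
    (h : ∀ u : List Bool, IsFactor w u → (abelianReturnClasses w u).encard ≤ 3)
    {m T n t s : ℕ} {q : ℕ → ℕ} (hq : ∀ i j, q i + p j = q j + p i)
    (hq0 : ∀ i, onesBefore w (q i) = i + s) (hq1 : ∀ i, onesBefore w (q i + 1) = i + s)
    (hM : ∀ x, q 0 ≤ x → onesBefore w (x + n) = onesBefore w x + t →
      ∃ i, p (i + m) = p i + T ∧ (x = q i ∨ x = q i + 1))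
    (hM0 : ∀ i, p (i + m) = p i + T → onesBefore w (q i + n) = onesBefore w (q i) + t)
    (hM1 : ∀ i, p (i + m) = p i + T →
      onesBefore w (q i + 1 + n) = onesBefore w (q i + 1) + t) :
    (spanReturns p m T).encard ≤ 2 := by
  have hm : ∀ i, q i + 2 ≤ q (i + 1) := fun i => by
    have := hq i (i + 1)
    have := hp.gap i
    omega
  have hqm : StrictMono q := strictMono_nat_of_lt_succ fun i => by have := hm i; omega
  have hqm2 : ∀ i j, i < j → q i + 2 ≤ q j := fun i j hij =>
    (hm i).trans (hqm.monotone hij)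
  rcases (spanReturns p m T).eq_empty_or_nonempty with he | ⟨r₀, i₀, -, hi₀, -⟩
  · simp [he]
  set u := factorAt w (q i₀) n with hu
  have hocc := mem_abelianOccurrences_iff (hM0 i₀ hi₀)
  let φ : Multiset Bool → ℕ × ℕ := fun s => (s.count true, Multiset.card s + 1)
  have key : ∀ x y, x ∈ AbelianOccurrences w u → y ∈ AbelianOccurrences w u → x < y →
      (∀ k, x < k → k < y → k ∉ AbelianOccurrences w u) →
      (onesBefore w y - onesBefore w x, y - x + 1) ∈ φ '' abelianReturnClasses w u := by
    intro x y hx hy hxy hk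
    refine ⟨_, ⟨_, ⟨x, y, hx, hy, hxy, hk, rfl⟩, rfl⟩, ?_⟩
    have := count_true_factorAt w x (y - x)
    rw [Nat.add_sub_cancel' hxy.le] at this
    simp only [φ, Multiset.coe_count, Multiset.coe_card, length_factorAt, Prod.mk.injEq,
      and_true]
    omega
  have hsub : insert (0, 2) (spanReturns p m T) ⊆ φ '' abelianReturnClasses w u := by
    rintro r (rfl | ⟨i, hr, hi, hj, hbet, hlen⟩)
    · have := key (q i₀) (q i₀ + 1) ((hocc _).2 (hM0 _ hi₀)) ((hocc _).2 (hM1 _ hi₀))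
        (by omega) (by intros; omega)
      rw [hq0, hq1] at this
      simpa using this
    · have h2 := hqm2 i (i + r.1) (by omega)
      have := key (q i + 1) (q (i + r.1)) ((hocc _).2 (hM1 _ hi)) ((hocc _).2 (hM0 _ hj))
        (by omega) (by
          intro x hx1 hx2 hx
          obtain ⟨k, hk, hxk⟩ := hM x
            (by have := hqm.monotone (Nat.zero_le i); omega) ((hocc _).1 hx)
          refine hbet k ?_ ?_ hk
          · rw [← hqm.lt_iff_lt]
            by_contra! hle
            rcases hle.eq_or_lt with e | e
            · omega
            · omega
          · rw [← hqm.lt_iff_lt]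
            omega)
      rw [hq0, hq1] at this
      have e := hq i (i + r.1)
      convert this using 1
      ext <;> simp <;> omega
  have hnot : ((0, 2) : ℕ × ℕ) ∉ spanReturns p m T := by
    rintro ⟨i, hr, -⟩
    exact absurd hr (lt_irrefl _)
  have h3 := (Set.encard_le_encard hsub).trans
    ((Set.encard_image_le φ _).trans (h u ⟨q i₀, by rw [hu, length_factorAt]⟩))
  rw [Set.encard_insert_of_notMem hnot] at h3
  exact (ENat.add_le_add_iff_right ENat.one_ne_top).1
    (h3.trans_eq (by norm_num))

theorem encard_spanReturns_le_of_max (hp : OnesEnum w p A B) (hA : 2 ≤ A) (hB : 2 ≤ B)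
    (h : ∀ u : List Bool, IsFactor w u → (abelianReturnClasses w u).encard ≤ 3)
    {m T : ℕ} (hT : 2 ≤ T)
    (hspan : ∀ i, p (i + (m + 1)) = p i + T ∨ p (i + (m + 1)) + 2 ≤ p i + T) :
    (spanReturns p (m + 1) T).encard ≤ 2 := by
  have hm := hp.strictMono hA hB
  have hgap : ∀ i, p i + 2 ≤ p (i + 1) := fun i => by have := hp.gap i; omega
  have hN := hp.onesBefore_eq_succ_iff hA hB
  have h0 : ∀ i, onesBefore w (p i + 1) = i + 1 := fun i => by
    rw [hN]; have := hgap i; omega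
  have h1 : ∀ i, onesBefore w (p i + 1 + 1) = i + 1 := fun i => by
    rw [hN]; have := hgap i; omega
  refine hp.encard_spanReturns_le hA hB h (n := T - 2) (t := m) (s := 1)
    (q := fun i => p i + 1) (by intros; omega) h0 h1 ?_ ?_ ?_
  · intro x hx hw
    have hne : ¬ onesBefore w x ≤ 0 := by
      rw [hp.onesBefore_le_iff hA hB]
      omega
    obtain ⟨i, hi⟩ := Nat.exists_eq_succ_of_ne_zero (fun e => hne e.le)
    have hx1 := (hN x i).1 hi
    rw [hi, show i.succ + m = (i + m) + 1 by omega, hN] at hw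
    have := hspan i
    rw [← add_assoc] at this
    refine ⟨i, ?_, ?_⟩
    · rw [← add_assoc]; omega
    · omega
  · intro i hi
    have := hgap (i + m)
    rw [← add_assoc] at hi
    rw [h0, show i + 1 + m = (i + m) + 1 by omega, hN]
    omega
  · intro i hi
    have := hgap (i + m)
    rw [← add_assoc] at hi
    rw [h1, show i + 1 + m = (i + m) + 1 by omega, hN]
    omega

theorem encard_spanReturns_le_of_min (hp : OnesEnum w p A B) (hA : 2 ≤ A) (hB : 2 ≤ B)
    (h : ∀ u : List Bool, IsFactor w u → (abelianReturnClasses w u).encard ≤ 3)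
    {m T : ℕ} (hspan : ∀ i, p (i + m) = p i + T ∨ p i + T + 2 ≤ p (i + m)) :
    (spanReturns p m T).encard ≤ 2 := by
  have hm := hp.strictMono hA hB
  have hpos : ∀ i, 0 < p i := fun i => hp.zero_pos.trans_le (hm.monotone (Nat.zero_le i))
  have hgap : ∀ i, p i + 2 ≤ p (i + 1) := fun i => by have := hp.gap i; omega
  have hN := hp.onesBefore_eq_succ_iff hA hB
  have h1 : ∀ i, onesBefore w (p i - 1 + 1) = i := fun i => by
    rw [Nat.sub_add_cancel (hpos i), hp.onesBefore_apply hA hB]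
  have h0 : ∀ i, onesBefore w (p i - 1) = i := fun i => by
    cases i with
    | zero =>
      have := (hp.onesBefore_le_iff hA hB (p 0 - 1) 0).2 (Nat.sub_le _ _)
      omega
    | succ i => rw [hN]; have := hgap i; omega
  refine hp.encard_spanReturns_le hA hB h (n := T + 2) (t := m + 1) (s := 0)
    (q := fun i => p i - 1) (fun i j => by have := hpos i; have := hpos j; omega)
    h0 h1 ?_ ?_ ?_
  · intro x _ hw
    rw [← add_assoc _ m 1, hN] at hw
    have hx := (hp.onesBefore_le_iff hA hB x (onesBefore w x)).1 le_rfl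
    have := hspan (onesBefore w x)
    refine ⟨onesBefore w x, ?_, ?_⟩ <;> omega
  · intro i hi
    have := hgap (i + m)
    have := hpos i
    rw [h0, ← add_assoc i m 1, hN]
    omega
  · intro i hi
    have := hgap (i + m)
    have := hpos i
    rw [h1, ← add_assoc i m 1, hN]
    omega

end OnesEnum

/-- `g (i + 1), …, g (i + k)` is a maximal run of `X` bounded by the letter `Y`. -/
structure IsRun (g : ℕ → ℕ) (X Y i k : ℕ) : Prop where
  pos : 0 < k
  left : g i = Y
  mid : ∀ j, 0 < j → j ≤ k → g (i + j) = X
  right : g (i + k + 1) = Y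

theorem IsRun.last {g : ℕ → ℕ} {X Y i k : ℕ} (h : IsRun g X Y i k) : g (i + k) = X :=
  h.mid k h.pos le_rfl

theorem exists_isRun {g : ℕ → ℕ} {X Y : ℕ} (hg : ∀ i, g i = X ∨ g i = Y)
    (hX : ∀ N, ∃ n, N ≤ n ∧ g n ≠ X) {i : ℕ} (h0 : g i = Y) (h1 : g (i + 1) = X) :
    ∃ k, IsRun g X Y i k := by
  classical
  have hex : ∃ k, g (i + k + 1) ≠ X := by
    obtain ⟨n, hn, hgn⟩ := hX (i + 1)
    exact ⟨n - i - 1, by rwa [show i + (n - i - 1) + 1 = n by omega]⟩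
  refine ⟨Nat.find hex, ?_, h0, fun j hj hjk => ?_, (hg _).resolve_left (Nat.find_spec hex)⟩
  · rw [Nat.find_pos]
    exact fun hne => hne h1
  · have := Nat.find_min hex (m := j - 1) (by omega)
    rwa [not_not, show i + (j - 1) + 1 = i + j by omega] at this

theorem ultimatelyPeriodic_of_isRun_unique {g : ℕ → ℕ} {A B : ℕ}
    (hg : ∀ i, g i = A ∨ g i = B)
    (hA : ∀ i k i' k', IsRun g A B i k → IsRun g A B i' k' → k = k')
    (hB : ∀ i k i' k', IsRun g B A i k → IsRun g B A i' k' → k = k') :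
    UltimatelyPeriodic g := by
  by_cases hc : ∃ c N, ∀ n, N ≤ n → g n = c
  · obtain ⟨c, N, hN⟩ := hc
    exact ⟨N, 1, one_pos, fun n hn => by rw [hN n hn, hN (n + 1) (by omega)]⟩
  push Not at hc
  obtain ⟨a, -, ha⟩ := hc A 0
  obtain ⟨b, hab, hb⟩ := hc B a
  replace ha := (hg a).resolve_left ha
  obtain ⟨l, hl⟩ : ∃ i, g i = B ∧ g (i + 1) = A := by
    by_contra! hne
    refine hb (Nat.le_induction ha (fun n _ hn => ?_) b hab)
    exact (hg _).resolve_left (hne n hn)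
  obtain ⟨k, hk⟩ := exists_isRun hg (hc A) hl.1 hl.2
  obtain ⟨k', hk'⟩ := exists_isRun (fun i => (hg i).symm) (hc B) hk.last hk.right
  have step : ∀ q, IsRun g A B (l + q * (k + k')) k ∧
      IsRun g B A (l + q * (k + k') + k) k' := by
    intro q
    induction q with
    | zero => simpa using ⟨hk, hk'⟩
    | succ q ih =>
      obtain ⟨r, hr⟩ := exists_isRun hg (hc A) ih.2.last ih.2.right
      obtain rfl := hA _ _ _ _ hr hk
      obtain ⟨r', hr'⟩ := exists_isRun (fun i => (hg i).symm) (hc B) hr.last hr.right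
      obtain rfl := hB _ _ _ _ hr' hk'
      rw [show l + (q + 1) * (r + r') = l + q * (r + r') + r + r' by ring]
      exact ⟨hr, hr'⟩
  have hpos := hk.pos
  have val : ∀ q r, r < k + k' →
      g (l + 1 + q * (k + k') + r) = if r < k then A else B := by
    intro q r hr
    split_ifs with hrk
    · rw [← (step q).1.mid (r + 1) (by omega) (by omega)]
      congr 1
      omega
    · rw [← (step q).2.mid (r + 1 - k) (by omega) (by omega)]
      congr 1
      omega
  refine ⟨l + 1, k + k', by omega, fun n hn => ?_⟩
  have hlt := Nat.mod_lt (n - (l + 1)) (show 0 < k + k' by omega)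
  have hdm := Nat.div_add_mod' (n - (l + 1)) (k + k')
  set q := (n - (l + 1)) / (k + k')
  set r := (n - (l + 1)) % (k + k')
  rw [show n = l + 1 + q * (k + k') + r by omega, val q r hlt, ← val (q + 1) r hlt]
  congr 1
  ring

theorem three_le_encard_of_mem {β : Type*} {s : Set β} {x y z : β} (hx : x ∈ s) (hy : y ∈ s)
    (hz : z ∈ s) (hxy : x ≠ y) (hxz : x ≠ z) (hyz : y ≠ z) : 3 ≤ s.encard := by
  rw [← Set.encard_eq_three.2 ⟨x, y, z, hxy, hxz, hyz, rfl⟩]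
  refine Set.encard_le_encard ?_
  rintro _ (rfl | rfl | rfl) <;> assumption

theorem isRun_unique {p g : ℕ → ℕ} {X Y : ℕ} (hXY : X ≠ Y) (hp : ∀ i, p (i + 1) = p i + g i)
    (hg : ∀ i, g i = X ∨ g i = Y)
    (h1 : (spanReturns p 1 Y).encard ≤ 2)
    (h2 : (∀ i, g i = Y → g (i + 1) = X) → (spanReturns p 2 (X + Y)).encard ≤ 2)
    {i k i' k' : ℕ} (hr : IsRun g X Y i k) (hr' : IsRun g X Y i' k') : k = k' := by
  by_contra hne
  have hmono : Monotone p := monotone_nat_of_le_succ fun i => by rw [hp]; omega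
  by_cases hYY : ∀ i, g i = Y → g (i + 1) = X
  · have mem : ∀ {i k}, IsRun g X Y i k →
        (k, p (i + k) - p i) ∈ spanReturns p 2 (X + Y) := by
      intro i k h
      refine ⟨i, h.pos, ?_, ?_, fun j hj hjk => ?_, ?_⟩
      · have := hp i
        have := hp (i + 1)
        have := h.left
        have := h.mid 1 one_pos h.pos
        change p (i + 1 + 1) = _
        omega
      · have := hp (i + k)
        have := hp (i + k + 1)
        have := h.last
        have := h.right
        change p (i + k + 1 + 1) = p (i + k) + _
        omega
      · have := hp j
        have := hp (j + 1)
        have := h.mid (j - i) (by omega) (by simp only at hjk; omega)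
        have := h.mid (j + 1 - i) (by omega) (by simp only at hjk; omega)
        rw [Nat.add_sub_cancel' (by omega)] at *
        change p (j + 1 + 1) ≠ _
        omega
      · exact (Nat.add_sub_cancel' (hmono (Nat.le_add_right i k))).symm
    have mem1 : (1, X) ∈ spanReturns p 2 (X + Y) := by
      refine ⟨i + k, one_pos, ?_, ?_, by intros; omega, ?_⟩
      · have := hp (i + k)
        have := hp (i + k + 1)
        have := hr.last
        have := hr.right
        change p (i + k + 1 + 1) = _
        omega
      · have := hp (i + k + 1)
        have := hp (i + k + 1 + 1)
        have := hr.right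
        have := hYY _ hr.right
        change p (i + k + 1 + 1 + 1) = p (i + k + 1) + _
        omega
      · rw [hp, hr.last]
    have ne1 : ∀ {i k}, IsRun g X Y i k → ((1, X) : ℕ × ℕ) ≠ (k, p (i + k) - p i) := by
      intro i k h heq
      obtain ⟨rfl, he⟩ := Prod.mk.inj heq
      have := hp i
      have := h.left
      omega
    have := (three_le_encard_of_mem mem1 (mem hr) (mem hr') (ne1 hr) (ne1 hr')
      (fun e => hne (Prod.mk.inj e).1)).trans (h2 hYY)
    exact absurd this (by norm_num)
  · push Not at hYY
    obtain ⟨j, hj, hj1⟩ := hYY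
    replace hj1 := (hg _).resolve_left hj1
    have mem : ∀ {i k}, IsRun g X Y i k →
        (k + 1, p (i + (k + 1)) - p i) ∈ spanReturns p 1 Y := by
      intro i k h
      refine ⟨i, Nat.succ_pos k, ?_, ?_, fun j hj hjk => ?_, ?_⟩
      · rw [hp, h.left]
      · rw [hp, ← add_assoc, h.right]
      · have := h.mid (j - i) (by omega) (by simp only at hjk; omega)
        rw [Nat.add_sub_cancel' hj.le] at this
        rw [hp, this]
        omega
      · exact (Nat.add_sub_cancel' (hmono (Nat.le_add_right i (k + 1)))).symm
    have mem1 : (1, Y) ∈ spanReturns p 1 Y :=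
      ⟨j, one_pos, by rw [hp, hj], by rw [hp, hj1], by intros; omega, by rw [hp, hj]⟩
    have hk := hr.pos
    have hk' := hr'.pos
    have := (three_le_encard_of_mem mem1 (mem hr) (mem hr')
      (fun e => by have := (Prod.mk.inj e).1; omega)
      (fun e => by have := (Prod.mk.inj e).1; omega)
      (fun e => hne (by have := (Prod.mk.inj e).1; omega))).trans h1
    exact absurd this (by norm_num)

theorem Recurrent.periodic_of_ultimatelyPeriodic {w : ℕ → α} (hr : Recurrent w)
    (hu : UltimatelyPeriodic w) : Periodic w := by
  obtain ⟨N, T, hT, hN⟩ := hu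
  refine ⟨T, hT, fun n => ?_⟩
  obtain ⟨i, hi, he⟩ := hr (factorAt w n (T + 1)) ⟨n, by rw [length_factorAt]⟩ N
  rw [length_factorAt] at he
  simp only [factorAt, List.map_inj_left, List.mem_range] at he
  rw [← he T (by omega), hN i hi]
  exact he 0 (by omega)

namespace OnesEnum

variable {w : ℕ → Bool} {p : ℕ → ℕ} {A B : ℕ}

theorem ultimatelyPeriodic (hp : OnesEnum w p A B) (hA : 2 ≤ A) (hB : 2 ≤ B)
    (hu : UltimatelyPeriodic fun i => p (i + 1) - p i) : UltimatelyPeriodic w := by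
  obtain ⟨N, T, hT, hN⟩ := hu
  have hm := hp.strictMono hA hB
  have hlt : p N < p (N + T) := hm (by omega)
  have hadd : ∀ n, N ≤ n → p (n + T) = p n + (p (N + T) - p N) := by
    refine Nat.le_induction (by omega) fun n hn ih => ?_
    have h1 := hN n hn
    simp only at h1
    have h2 := hm (Nat.lt_succ_self (n + T))
    have h3 := hm (Nat.lt_succ_self n)
    rw [show n + 1 + T = n + T + 1 by omega]
    simp only [Nat.succ_eq_add_one] at h2 h3
    omega
  refine ⟨p N, p (N + T) - p N, by omega, fun x hx => ?_⟩
  rw [Bool.eq_iff_iff, hp.mem_iff, hp.mem_iff]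
  constructor
  · rintro ⟨j, hj⟩
    have hle : N + T ≤ j := hm.le_iff_le.1 (by omega)
    obtain ⟨i, rfl⟩ := Nat.exists_eq_add_of_le' (show T ≤ j by omega)
    have := hadd i (by omega)
    exact ⟨i, by omega⟩
  · rintro ⟨i, rfl⟩
    exact ⟨i + T, hadd i (hm.le_iff_le.1 hx)⟩

end OnesEnum

theorem InfConcat.exists_onesEnum {w : ℕ → Bool} {l₁ l₂ : ℕ} (h₁ : 0 < l₁) (h₂ : 0 < l₂)
    (hconc : InfConcat
      {List.replicate l₁ false ++ [true], List.replicate l₂ false ++ [true]} w) :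
    ∃ p, OnesEnum w p (l₁ + 1) (l₂ + 1) := by
  obtain ⟨f, hf, hw⟩ := hconc
  set s : ℕ → ℕ := fun n => ((List.range n).map fun k => (f k).length).sum with hs
  have hs0 : s 0 = 0 := by simp [hs]
  have hblock : ∀ n, ∃ l, (l = l₁ ∨ l = l₂) ∧ s (n + 1) = s n + (l + 1) ∧
      ∀ j, j ≤ l → (w (s n + j) = true ↔ j = l) := by
    intro n
    obtain ⟨l, hl, hfl⟩ : ∃ l, (l = l₁ ∨ l = l₂) ∧ f n = List.replicate l false ++ [true] := by
      rcases hf n with h | h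
      · exact ⟨l₁, Or.inl rfl, h⟩
      · exact ⟨l₂, Or.inr rfl, h⟩
    refine ⟨l, hl, by simp [hs, List.range_succ, hfl], fun j hj => ?_⟩
    have hn := congrArg (fun u => u[j]?) (hw n)
    simp only [factorAt, hfl, List.length_append, List.length_replicate, List.length_singleton,
      List.getElem?_map, List.getElem?_range (show j < l + 1 by omega), Option.map_some,
      List.getElem?_append, List.getElem?_replicate] at hn
    change some (w (s n + j)) = _ at hn
    rcases hj.eq_or_lt with rfl | hlt
    · simpa using hn
    · simp only [hlt, if_true, Option.some.injEq] at hn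
      simp [hn, hlt.ne]
  have hlt : StrictMono s := strictMono_nat_of_lt_succ fun n => by
    obtain ⟨l, -, h, -⟩ := hblock n
    omega
  have hpos : ∀ n, 0 < s (n + 1) := fun n => by
    have : s n < s (n + 1) := hlt (Nat.lt_succ_self n)
    omega
  refine ⟨fun i => s (i + 1) - 1, fun x => ⟨fun hx => ?_, ?_⟩, fun i => ?_, ?_⟩
  · obtain ⟨n, hn1, hn2⟩ : ∃ n, s n ≤ x ∧ x < s (n + 1) := by
      classical
      have hex : ∃ n, x < s (n + 1) := ⟨x, hlt.le_apply⟩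
      refine ⟨Nat.find hex, ?_, Nat.find_spec hex⟩
      rcases h : Nat.find hex with _ | m
      · omega
      · have := Nat.find_min hex (m := m) (by omega)
        omega
    obtain ⟨l, -, h, hj⟩ := hblock n
    have := (hj (x - s n) (by omega)).1 (by rwa [Nat.add_sub_cancel' hn1])
    exact ⟨n, by omega⟩
  · rintro ⟨n, rfl⟩
    obtain ⟨l, -, h, hj⟩ := hblock n
    rw [show s (n + 1) - 1 = s n + l by omega]
    exact (hj l le_rfl).2 rfl
  · obtain ⟨l, hl, h, -⟩ := hblock (i + 1)
    have := hpos i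
    omega
  · obtain ⟨l, hl, h, -⟩ := hblock 0
    omega

/-- If `0 < l₁ < l₂`, `w` is an aperiodic recurrent infinite binary word
which is an infinite concatenation of words from `{0^l₁ 1, 0^l₂ 1}`, and each factor of `w`
has at most three abelian returns, then `l₂ = l₁ + 1`. -/
theorem l2_eq_l1_add_one_of_at_most_three_abelian_returns
    (l₁ l₂ : ℕ) (h₁ : 0 < l₁) (h₁₂ : l₁ < l₂)
    (w : ℕ → Bool) (hap : Aperiodic w) (hrec : Recurrent w)
    (hconc : InfConcat
      {List.replicate l₁ false ++ [true], List.replicate l₂ false ++ [true]} w)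
    (h : ∀ u : List Bool, IsFactor w u → (abelianReturnClasses w u).encard ≤ 3) :
    l₂ = l₁ + 1 := by
  by_contra hne
  obtain ⟨p, hp⟩ := hconc.exists_onesEnum h₁ (h₁.trans h₁₂)
  have hA : 2 ≤ l₁ + 1 := by omega
  have hB : 2 ≤ l₂ + 1 := by omega
  set g : ℕ → ℕ := fun i => p (i + 1) - p i with hg
  have hpg : ∀ i, p (i + 1) = p i + g i := fun i =>
    (Nat.add_sub_cancel' (hp.strictMono hA hB (Nat.lt_succ_self i)).le).symm
  have hgv : ∀ i, g i = l₁ + 1 ∨ g i = l₂ + 1 := fun i => by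
    have := hp.gap i
    have := hpg i
    omega
  refine hap (hrec.periodic_of_ultimatelyPeriodic (hp.ultimatelyPeriodic hA hB
    (ultimatelyPeriodic_of_isRun_unique (A := l₁ + 1) (B := l₂ + 1) hgv ?_ ?_)))
  · refine fun i k i' k' => isRun_unique (by omega) hpg hgv
      (hp.encard_spanReturns_le_of_max hA hB h (m := 0) hB fun j => ?_)
      fun hBB => hp.encard_spanReturns_le_of_max hA hB h (m := 1) (by omega) fun j => ?_
    · have := hgv j
      have := hpg j
      rw [zero_add]
      omega
    · have := hgv j
      have := hgv (j + 1)
      have := hBB j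
      have := hpg j
      have := hpg (j + 1)
      change p (j + 1 + 1) = _ ∨ p (j + 1 + 1) + 2 ≤ _
      omega
  · refine fun i k i' k' => isRun_unique (by omega) hpg (fun j => (hgv j).symm)
      (hp.encard_spanReturns_le_of_min hA hB h fun j => ?_)
      fun hAA => hp.encard_spanReturns_le_of_min hA hB h fun j => ?_
    · have := hgv j
      have := hpg j
      omega
    · have := hgv j
      have := hgv (j + 1)
      have := hAA j
      have := hpg j
      have := hpg (j + 1)
      change p (j + 1 + 1) = _ ∨ _ ≤ p (j + 1 + 1)
      omega
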